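/- arXiv:1304.7890 — 4 statements merged into one kernel-verified Lean document; each statement's English description precedes it below -/
import Mathlib

section
/- Let A be an m × n complex matrix of rank a, and let P (n × n) and Q (m × m) be invertible complex matrices such that QAP = E_a = [[I_a, 0], [0, 0]]. Then every {1}-inverse of A has Rohde's form: if X ∈ ℂ^{n×m} satisfies AXA = A, then there exist matrices U ∈ ℂ^{a×(m−a)}, V ∈ ℂ^{(n−a)×a}, W ∈ ℂ^{(n−a)×(m−a)} such that X = P · [[I_a, U], [V, W]] · Q. -/
open Matrix

/-- 2×2 block matrix with row split at `a` and column split at `b`. -/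
noncomputable def blk (n m a b : ℕ) (TL : Matrix (Fin a) (Fin b) ℂ)
    (TR : Matrix (Fin a) (Fin (m - b)) ℂ) (BL : Matrix (Fin (n - a)) (Fin b) ℂ)
    (BR : Matrix (Fin (n - a)) (Fin (m - b)) ℂ) : Matrix (Fin n) (Fin m) ℂ :=
  fun i j =>
    if hi : (i : ℕ) < a then
      if hj : (j : ℕ) < b then TL ⟨i, hi⟩ ⟨j, hj⟩
      else TR ⟨i, hi⟩ ⟨(j : ℕ) - b, by have := j.isLt; omega⟩
    else
      if hj : (j : ℕ) < b then BL ⟨(i : ℕ) - a, by have := i.isLt; omega⟩ ⟨j, hj⟩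
      else BR ⟨(i : ℕ) - a, by have := i.isLt; omega⟩ ⟨(j : ℕ) - b, by have := j.isLt; omega⟩

/-- Column-wise stacking: upper block `T` (first `a` rows), lower block `B` (last `n - a` rows). -/
noncomputable def vstack (n k a : ℕ) (T : Matrix (Fin a) (Fin k) ℂ)
    (B : Matrix (Fin (n - a)) (Fin k) ℂ) : Matrix (Fin n) (Fin k) ℂ :=
  blk n k a k T 0 B 0

/-- Row-wise stacking: left block `L` (first `b` columns), right block `R'` (last `n - b` columns). -/
noncomputable def hstack (k n b : ℕ) (L : Matrix (Fin k) (Fin b) ℂ)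
    (R' : Matrix (Fin k) (Fin (n - b)) ℂ) : Matrix (Fin k) (Fin n) ℂ :=
  blk k n k b L R' 0 0

/-- The first `a` rows of a matrix. -/
noncomputable def upperRows (a : ℕ) {m k : ℕ} (M : Matrix (Fin m) (Fin k) ℂ) :
    Matrix (Fin a) (Fin k) ℂ :=
  fun i j => if h : (i : ℕ) < m then M ⟨i, h⟩ j else 0

/-- The last `m - a` rows of a matrix. -/
noncomputable def lowerRows (a : ℕ) {m k : ℕ} (M : Matrix (Fin m) (Fin k) ℂ) :
    Matrix (Fin (m - a)) (Fin k) ℂ :=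
  fun i j => M ⟨a + i, by have := i.isLt; omega⟩ j

/-- The first `b` columns of a matrix. -/
noncomputable def leftCols (b : ℕ) {k m : ℕ} (M : Matrix (Fin k) (Fin m) ℂ) :
    Matrix (Fin k) (Fin b) ℂ :=
  fun i j => if h : (j : ℕ) < m then M i ⟨j, h⟩ else 0

/-- The last `m - b` columns of a matrix. -/
noncomputable def rightCols (b : ℕ) {k m : ℕ} (M : Matrix (Fin k) (Fin m) ℂ) :
    Matrix (Fin k) (Fin (m - b)) ℂ :=
  fun i j => M i ⟨b + j, by have := j.isLt; omega⟩

theorem blkE_apply (m n a : ℕ) (i : Fin m) (j : Fin n) :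
    blk m n a a 1 0 0 0 i j = if (i : ℕ) = j ∧ (i : ℕ) < a then (1 : ℂ) else 0 := by
  unfold blk
  by_cases hi : (i : ℕ) < a <;> by_cases hj : (j : ℕ) < a <;>
    simp [hi, hj, Matrix.one_apply, Fin.ext_iff]
  omega

theorem blkE_mul_left (m n k a : ℕ) (M : Matrix (Fin n) (Fin k) ℂ) (i : ℕ) (him : i < m)
    (hin : i < n) (hi : i < a) (j : Fin k) :
    (blk m n a a 1 0 0 0 * M) ⟨i, him⟩ j = M ⟨i, hin⟩ j := by
  rw [Matrix.mul_apply, Finset.sum_eq_single ⟨i, hin⟩]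
  · simp [blkE_apply, hi]
  · intro b _ hb
    have : i ≠ (b : ℕ) := fun h => hb (Fin.ext h.symm)
    simp [blkE_apply, this]
  · simp

theorem blkE_mul_right (m n k a : ℕ) (M : Matrix (Fin k) (Fin m) ℂ) (i : ℕ) (him : i < m)
    (hin : i < n) (hi : i < a) (j : Fin k) :
    (M * blk m n a a 1 0 0 0) j ⟨i, hin⟩ = M j ⟨i, him⟩ := by
  rw [Matrix.mul_apply, Finset.sum_eq_single ⟨i, him⟩]
  · simp [blkE_apply, hi]
  · intro b _ hb
    have : (b : ℕ) ≠ i := fun h => hb (Fin.ext h)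
    simp [blkE_apply, this]
  · simp

theorem statement_1 (m n a : ℕ) (A : Matrix (Fin m) (Fin n) ℂ) (hrank : A.rank = a)
    (P : Matrix (Fin n) (Fin n) ℂ) (Q : Matrix (Fin m) (Fin m) ℂ)
    (hP : IsUnit P) (hQ : IsUnit Q)
    (hQAP : Q * A * P = blk m n a a 1 0 0 0)
    (X : Matrix (Fin n) (Fin m) ℂ) (hX : A * X * A = A) :
    ∃ (U : Matrix (Fin a) (Fin (m - a)) ℂ) (V : Matrix (Fin (n - a)) (Fin a) ℂ)
      (W : Matrix (Fin (n - a)) (Fin (m - a)) ℂ),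
      X = P * blk n m a a 1 U V W * Q := by
  have ham : a ≤ m := by
    rw [← hrank]; simpa using A.rank_le_card_height
  have han : a ≤ n := by
    rw [← hrank]; simpa using A.rank_le_card_width
  obtain ⟨p, rfl⟩ := hP
  obtain ⟨q, rfl⟩ := hQ
  obtain ⟨Y, hY⟩ : ∃ Y : Matrix (Fin n) (Fin m) ℂ, X = p.val * Y * q.val := by
    refine ⟨(p⁻¹).val * X * (q⁻¹).val, ?_⟩
    have h1 : p.val * (p⁻¹).val = 1 := p.mul_inv
    have h2 : (q⁻¹).val * q.val = 1 := q.inv_mul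
    calc X = (p.val * (p⁻¹).val) * X * ((q⁻¹).val * q.val) := by
          rw [h1, h2, Matrix.one_mul, Matrix.mul_one]
      _ = _ := by simp only [Matrix.mul_assoc]
  have hE : blk m n a a 1 0 0 0 * Y * blk m n a a 1 0 0 0 = blk m n a a 1 0 0 0 := by
    rw [← hQAP]
    calc _ = q.val * (A * (p.val * Y * q.val) * A) * p.val := by
          simp only [Matrix.mul_assoc]
      _ = _ := by rw [← hY, hX]
  have hTL : ∀ (i j : ℕ) (hi : i < a) (hj : j < a),
      Y ⟨i, hi.trans_le han⟩ ⟨j, hj.trans_le ham⟩ = if i = j then 1 else 0 := by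
    intro i j hi hj
    have h := congrFun (congrFun hE ⟨i, hi.trans_le ham⟩) ⟨j, hj.trans_le han⟩
    rw [blkE_mul_right m n m a _ j (hj.trans_le ham) _ hj,
      blkE_mul_left m n m a _ i _ (hi.trans_le han) hi, blkE_apply] at h
    simpa [hi] using h
  refine ⟨fun i j => Y ⟨i, by omega⟩ ⟨a + j, by omega⟩,
    fun i j => Y ⟨a + i, by omega⟩ ⟨j, by omega⟩,
    fun i j => Y ⟨a + i, by omega⟩ ⟨a + j, by omega⟩, ?_⟩
  rw [hY]
  congr 2
  ext i j
  unfold blk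
  by_cases hi : (i : ℕ) < a <;> by_cases hj : (j : ℕ) < a
  · simpa [hi, hj, Matrix.one_apply] using hTL i j hi hj
  · have h2 : a + ((j : ℕ) - a) = j := by omega
    simp [hi, hj, h2]
  · have h2 : a + ((i : ℕ) - a) = i := by omega
    simp [hi, hj, h2]
  · have h1 : a + ((i : ℕ) - a) = i := by omega
    have h2 : a + ((j : ℕ) - a) = j := by omega
    simp [hi, hj, h1, h2]
end

section
/- Let A be an m × n complex matrix of rank a, let P (n × n) and Q (m × m) be invertible with QAP = E_a = [[I_a, 0], [0, 0]], and let A⁽¹⁾ = P · [[I_a, U], [V, W]] · Q be a {1}-inverse of A in Rohde's form. Let C ∈ ℂ^{m×k} be such that QC = C' = [C'_a ; 0] (the last m − a rows of QC are zero), and let Y ∈ ℂ^{n×k} be arbitrary with P⁻¹Y = Y' = [Y'_a ; Y'_{n−a}] (Y'_a its first a rows, Y'_{n−a} its last n − a rows). Then A⁽¹⁾C + (I − A⁽¹⁾A)Y = P · [C'_a ; V(C'_a − Y'_a) + Y'_{n−a}], the block matrix with upper block C'_a and lower block V(C'_a − Y'_a) + Y'_{n−a}. -/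
open Matrix

theorem sum_aux (m a : ℕ) (h : a ≤ m) (f : Fin m → ℂ) (hf : ∀ i : Fin m, a ≤ (i : ℕ) → f i = 0) :
    ∑ i, f i = ∑ i : Fin a, f (Fin.castLE h i) := by
  obtain ⟨c, rfl⟩ := Nat.exists_eq_add_of_le h
  rw [Fin.sum_univ_add]
  rw [Finset.sum_eq_zero (s := (Finset.univ : Finset (Fin c)))]
  · rw [add_zero]; rfl
  · intro i _
    exact hf _ (by simp)

theorem blk_mul_aux (m n a k : ℕ) (hm : a ≤ m)
    (U : Matrix (Fin a) (Fin (m - a)) ℂ) (V : Matrix (Fin (n - a)) (Fin a) ℂ)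
    (W : Matrix (Fin (n - a)) (Fin (m - a)) ℂ) (D : Matrix (Fin m) (Fin k) ℂ)
    (hD : ∀ i : Fin m, a ≤ (i : ℕ) → ∀ j : Fin k, D i j = 0) :
    blk n m a a 1 U V W * D = vstack n k a (upperRows a D) (V * upperRows a D) := by
  ext i j
  rw [Matrix.mul_apply, sum_aux m a hm _ (fun i hi => by rw [hD i hi, mul_zero])]
  have hlt : ∀ x : Fin a, (x : ℕ) < m := fun x => lt_of_lt_of_le x.isLt hm
  by_cases hi : (i : ℕ) < a
  · simp [blk, vstack, hi, upperRows, Matrix.one_apply, Fin.castLE, lt_of_lt_of_le hi hm]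
  · simp [blk, vstack, hi, upperRows, Matrix.mul_apply, Fin.castLE, hlt]

theorem E_mul_aux (m n a k : ℕ) (hn : a ≤ n) (Y : Matrix (Fin n) (Fin k) ℂ) :
    blk m n a a 1 0 0 0 * Y = vstack m k a (upperRows a Y) 0 := by
  ext i j
  rw [Matrix.mul_apply, sum_aux n a hn _ (fun x hx => by
    have : ¬ (x : ℕ) < a := by omega
    simp [blk, this])]
  by_cases hi : (i : ℕ) < a
  · simp [blk, vstack, hi, upperRows, Matrix.one_apply, Fin.castLE, lt_of_lt_of_le hi hn]
  · simp [blk, vstack, hi]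

theorem statement_9 (m n a : ℕ) (A : Matrix (Fin m) (Fin n) ℂ) (hrank : A.rank = a)
    (P : Matrix (Fin n) (Fin n) ℂ) (Q : Matrix (Fin m) (Fin m) ℂ)
    (hP : IsUnit P) (hQ : IsUnit Q)
    (hQAP : Q * A * P = blk m n a a 1 0 0 0)
    (U : Matrix (Fin a) (Fin (m - a)) ℂ) (V : Matrix (Fin (n - a)) (Fin a) ℂ)
    (W : Matrix (Fin (n - a)) (Fin (m - a)) ℂ)
    (k : ℕ) (C : Matrix (Fin m) (Fin k) ℂ)
    (hC : ∀ i : Fin m, a ≤ (i : ℕ) → ∀ j : Fin k, (Q * C) i j = 0)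
    (Y : Matrix (Fin n) (Fin k) ℂ) :
    (P * blk n m a a 1 U V W * Q) * C + (1 - (P * blk n m a a 1 U V W * Q) * A) * Y =
      P * vstack n k a (upperRows a (Q * C))
        (V * (upperRows a (Q * C) - upperRows a (P⁻¹ * Y)) + lowerRows a (P⁻¹ * Y)) := by
  have hm : a ≤ m := by
    have := A.rank_le_card_height
    simp at this; omega
  have hn : a ≤ n := by
    have := A.rank_le_card_width
    simp at this; omega
  have hPd : IsUnit P.det := (Matrix.isUnit_iff_isUnit_det P).mp hP
  obtain ⟨Z, hZ⟩ : ∃ Z, Z = P⁻¹ * Y := ⟨_, rfl⟩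
  have hY : Y = P * Z := by rw [hZ, Matrix.mul_nonsing_inv_cancel_left _ _ hPd]
  rw [← hZ, hY]
  have key : (P * blk n m a a 1 U V W * Q) * C
      + (1 - (P * blk n m a a 1 U V W * Q) * A) * (P * Z)
      = P * (blk n m a a 1 U V W * (Q * C - (Q * A * P) * Z) + Z) := by
    simp only [Matrix.mul_add, Matrix.mul_sub, Matrix.sub_mul, Matrix.mul_assoc, Matrix.one_mul]
    abel
  rw [key, hQAP, E_mul_aux m n a k hn]
  have hD : ∀ i : Fin m, a ≤ (i : ℕ) → ∀ j : Fin k,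
      (Q * C - vstack m k a (upperRows a Z) 0) i j = 0 := by
    intro i hi j
    have : ¬ (i : ℕ) < a := by omega
    rw [Matrix.sub_apply, hC i hi j]
    simp [vstack, blk, this]
  rw [blk_mul_aux m n a k hm U V W _ hD]
  have hU : upperRows a (Q * C - vstack m k a (upperRows a Z) 0)
      = upperRows a (Q * C) - upperRows a Z := by
    ext i j
    have h1 : (i : ℕ) < m := by omega
    have h2 : (i : ℕ) < n := by omega
    simp [upperRows, vstack, blk, h1, h2]
  rw [hU]
  congr 1
  ext i j
  by_cases hi : (i : ℕ) < a
  · simp [vstack, blk, hi, upperRows]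
  · have : a + ((i : ℕ) - a) = i := by omega
    simp [vstack, blk, hi, lowerRows, this]
end

section
/- Let B be an n × m complex matrix of rank b, let R (n × n) and S (m × m) be invertible with RBS = E_b = [[I_b, 0], [0, 0]], and let B⁽¹⁾ = S · [[I_b, M], [N, K]] · R be a {1}-inverse of B in Rohde's form, for matrices M ∈ ℂ^{b×(n−b)}, N ∈ ℂ^{(m−b)×b}, K ∈ ℂ^{(m−b)×(n−b)}. Let d ∈ ℂ^{1×m} be such that dS = d' = [d'_b | 0] (the last m − b entries of dS are zero), and let y ∈ ℂ^{1×n} be arbitrary with yR⁻¹ = y' = [y'_b | y'_{n−b}] (y'_b its first b entries, y'_{n−b} its last n − b entries). Then d·B⁽¹⁾ + y(I − B·B⁽¹⁾) = [d'_b | (d'_b − y'_b)M + y'_{n−b}] · R, where [d'_b | (d'_b − y'_b)M + y'_{n−b}] is the row vector with left block d'_b and right block (d'_b − y'_b)M + y'_{n−b}. -/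
open Matrix

theorem sum_split_aux (m b : ℕ) (hb : b ≤ m) (f : Fin m → ℂ) :
    ∑ i, f i = ∑ i : Fin b, f ⟨i, by have := i.isLt; omega⟩ +
      ∑ i : Fin (m - b), f ⟨b + i, by have := i.isLt; omega⟩ := by
  have h : b + (m - b) = m := by omega
  rw [← Equiv.sum_comp (finCongr h) f, Fin.sum_univ_add]
  rfl

theorem hstack_left_right (k n b : ℕ) (X : Matrix (Fin k) (Fin n) ℂ) :
    hstack k n b (leftCols b X) (rightCols b X) = X := by
  ext i j
  by_cases hj : (j : ℕ) < b
  · simp [hstack, blk, leftCols, hj]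
  · have : b + ((j : ℕ) - b) = j := by omega
    simp [hstack, blk, rightCols, hj, this]

theorem leftCols_hstack (k n b : ℕ) (hb : b ≤ n) (L : Matrix (Fin k) (Fin b) ℂ)
    (Q : Matrix (Fin k) (Fin (n - b)) ℂ) : leftCols b (hstack k n b L Q) = L := by
  ext i j
  have : (j : ℕ) < n := by omega
  simp [hstack, blk, leftCols, this]

theorem rightCols_hstack (k n b : ℕ) (L : Matrix (Fin k) (Fin b) ℂ)
    (Q : Matrix (Fin k) (Fin (n - b)) ℂ) : rightCols b (hstack k n b L Q) = Q := by
  ext i j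
  simp [hstack, blk, rightCols]

theorem hstack_add (k n b : ℕ) (L L' : Matrix (Fin k) (Fin b) ℂ)
    (Q Q' : Matrix (Fin k) (Fin (n - b)) ℂ) :
    hstack k n b L Q + hstack k n b L' Q' = hstack k n b (L + L') (Q + Q') := by
  ext i j
  by_cases hj : (j : ℕ) < b <;> simp [hstack, blk, hj]

theorem hstack_sub (k n b : ℕ) (L L' : Matrix (Fin k) (Fin b) ℂ)
    (Q Q' : Matrix (Fin k) (Fin (n - b)) ℂ) :
    hstack k n b L Q - hstack k n b L' Q' = hstack k n b (L - L') (Q - Q') := by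
  ext i j
  by_cases hj : (j : ℕ) < b <;> simp [hstack, blk, hj]

theorem mul_blk (k m n b : ℕ) (hb : b ≤ m) (X : Matrix (Fin k) (Fin m) ℂ)
    (TL : Matrix (Fin b) (Fin b) ℂ) (TR : Matrix (Fin b) (Fin (n - b)) ℂ)
    (BL : Matrix (Fin (m - b)) (Fin b) ℂ) (BR : Matrix (Fin (m - b)) (Fin (n - b)) ℂ) :
    X * blk m n b b TL TR BL BR =
      hstack k n b (leftCols b X * TL + rightCols b X * BL)
        (leftCols b X * TR + rightCols b X * BR) := by
  ext i j
  have hl : ∀ x : Fin b, (x : ℕ) < m := fun x => by omega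
  rw [Matrix.mul_apply, sum_split_aux m b hb]
  by_cases hj : (j : ℕ) < b <;>
    simp [hstack, blk, hj, leftCols, rightCols, Matrix.mul_apply, hl]

theorem statement_12 (n m b : ℕ) (B : Matrix (Fin n) (Fin m) ℂ) (hrank : B.rank = b)
    (R : Matrix (Fin n) (Fin n) ℂ) (S : Matrix (Fin m) (Fin m) ℂ)
    (hR : IsUnit R) (hS : IsUnit S)
    (hRBS : R * B * S = blk n m b b 1 0 0 0)
    (M : Matrix (Fin b) (Fin (n - b)) ℂ) (N : Matrix (Fin (m - b)) (Fin b) ℂ)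
    (K : Matrix (Fin (m - b)) (Fin (n - b)) ℂ)
    (d : Matrix (Fin 1) (Fin m) ℂ) (hd : ∀ j : Fin m, b ≤ (j : ℕ) → (d * S) 0 j = 0)
    (y : Matrix (Fin 1) (Fin n) ℂ) :
    d * (S * blk m n b b 1 M N K * R) + y * (1 - B * (S * blk m n b b 1 M N K * R)) =
      hstack 1 n b (leftCols b (d * S))
        ((leftCols b (d * S) - leftCols b (y * R⁻¹)) * M + rightCols b (y * R⁻¹)) * R := by
  have hbm : b ≤ m := by
    rw [← hrank]; simpa using B.rank_le_width
  have hbn : b ≤ n := by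
    rw [← hrank]; simpa using B.rank_le_height
  have hdet : IsUnit R.det := (Matrix.isUnit_iff_isUnit_det R).mp hR
  have hy : y = y * R⁻¹ * R := by
    rw [Matrix.mul_assoc, Matrix.nonsing_inv_mul R hdet, Matrix.mul_one]
  have hr : rightCols b (d * S) = 0 := by
    ext i j
    have hi : i = 0 := Subsingleton.elim _ _
    subst hi
    exact hd _ (by simp)
  set y' := y * R⁻¹ with hy'
  set Z := blk m n b b 1 M N K with hZ
  have e1 : d * (S * Z * R) + y * (1 - B * (S * Z * R)) =
      (d * S * Z + (y' - y' * (R * B * S) * Z)) * R := by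
    rw [hy]
    simp only [Matrix.mul_sub, Matrix.add_mul, Matrix.sub_mul, Matrix.mul_assoc, Matrix.mul_one]
  rw [e1, hRBS, hZ, mul_blk 1 n m b hbn, mul_blk 1 m n b hbm, mul_blk 1 m n b hbm,
    leftCols_hstack _ _ _ hbm, rightCols_hstack, hr]
  nth_rewrite 1 [← hstack_left_right 1 n b y']
  rw [hstack_sub, hstack_add]
  simp only [Matrix.mul_one, Matrix.mul_zero, Matrix.zero_mul, add_zero, sub_self, Matrix.sub_mul]
  congr 2
  abel
end

section
/- Let B be an n × m complex matrix of rank b, let R (n × n) and S (m × m) be invertible with RBS = E_b = [[I_b, 0], [0, 0]], and let B⁽¹⁾ = S · [[I_b, M], [N, K]] · R be a {1}-inverse of B in Rohde's form. Let D ∈ ℂ^{k×m} be such that DS = D' = [D'_b | 0] (the last m − b columns of DS are zero), and let Y ∈ ℂ^{k×n} be arbitrary with YR⁻¹ = Y' = [Y'_b | Y'_{n−b}] (Y'_b its first b columns, Y'_{n−b} its last n − b columns). Then D·B⁽¹⁾ + Y(I − B·B⁽¹⁾) = [D'_b | (D'_b − Y'_b)M + Y'_{n−b}] · R, the block matrix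 with left block D'_b and right block (D'_b − Y'_b)M + Y'_{n−b}, multiplied on the right by R. -/
open Matrix

theorem sum_trunc (m b : ℕ) (h : b ≤ m) (f : Fin m → ℂ)
    (hf : ∀ j : Fin m, b ≤ (j : ℕ) → f j = 0) :
    ∑ j, f j = ∑ j : Fin b, f (Fin.castLE h j) := by
  obtain ⟨q, rfl⟩ := Nat.exists_eq_add_of_le h
  rw [Fin.sum_univ_add]
  have : ∑ i : Fin q, f (Fin.natAdd b i) = 0 :=
    Finset.sum_eq_zero fun i _ => hf _ (by simp)
  rw [this, add_zero]
  rfl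

theorem mul_blk_one (n m b k : ℕ) (hm : b ≤ m) (V : Matrix (Fin k) (Fin m) ℂ)
    (hV : ∀ j : Fin m, b ≤ (j : ℕ) → ∀ i : Fin k, V i j = 0)
    (M : Matrix (Fin b) (Fin (n - b)) ℂ) (N : Matrix (Fin (m - b)) (Fin b) ℂ)
    (K : Matrix (Fin (m - b)) (Fin (n - b)) ℂ) :
    V * blk m n b b 1 M N K = hstack k n b (leftCols b V) (leftCols b V * M) := by
  have hl : ∀ l : Fin b, (l : ℕ) < m := fun l => lt_of_lt_of_le l.isLt hm
  ext i j
  rw [Matrix.mul_apply, sum_trunc m b hm _ (fun j hj => by rw [hV j hj, zero_mul])]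
  by_cases hj : (j : ℕ) < b
  · simp only [blk, hstack, leftCols, Fin.val_castLE, Fin.is_lt, hj, dite_true, Matrix.one_apply]
    rw [Finset.sum_eq_single (⟨j, hj⟩ : Fin b)]
    · simp [lt_of_lt_of_le hj hm, Fin.castLE]
    · intro c _ hc
      simp [hc]
    · simp
  · simp [blk, hstack, leftCols, hj, Matrix.mul_apply, hl, Fin.castLE]

theorem mul_E (n m b k : ℕ) (hn : b ≤ n) (Y : Matrix (Fin k) (Fin n) ℂ) :
    Y * blk n m b b 1 0 0 0 = hstack k m b (leftCols b Y) 0 := by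
  have hl : ∀ l : Fin b, (l : ℕ) < n := fun l => lt_of_lt_of_le l.isLt hn
  have hs : Y * blk n m b b 1 0 0 0 =
      (hstack k n b (leftCols b Y) 0) * blk n m b b 1 0 0 0 := by
    ext i j
    rw [Matrix.mul_apply, Matrix.mul_apply]
    refine Finset.sum_congr rfl fun l _ => ?_
    by_cases h : (l : ℕ) < b
    · simp [hstack, blk, leftCols, h]
    · simp [blk, h]
  rw [hs, mul_blk_one m n b k hn]
  · congr 1
    · ext i j
      simp [hstack, blk, leftCols, hl]
    · simp
  · intro j hj i
    simp [hstack, blk, not_lt.mpr hj]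

theorem statement_15 (n m b : ℕ) (B : Matrix (Fin n) (Fin m) ℂ) (hrank : B.rank = b)
    (R : Matrix (Fin n) (Fin n) ℂ) (S : Matrix (Fin m) (Fin m) ℂ)
    (hR : IsUnit R) (hS : IsUnit S)
    (hRBS : R * B * S = blk n m b b 1 0 0 0)
    (M : Matrix (Fin b) (Fin (n - b)) ℂ) (N : Matrix (Fin (m - b)) (Fin b) ℂ)
    (K : Matrix (Fin (m - b)) (Fin (n - b)) ℂ)
    (k : ℕ) (D : Matrix (Fin k) (Fin m) ℂ)
    (hD : ∀ j : Fin m, b ≤ (j : ℕ) → ∀ i : Fin k, (D * S) i j = 0)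
    (Y : Matrix (Fin k) (Fin n) ℂ) :
    D * (S * blk m n b b 1 M N K * R) + Y * (1 - B * (S * blk m n b b 1 M N K * R)) =
      hstack k n b (leftCols b (D * S))
        ((leftCols b (D * S) - leftCols b (Y * R⁻¹)) * M + rightCols b (Y * R⁻¹)) * R := by
  have hm : b ≤ m := by
    have := B.rank_le_width
    omega
  have hn : b ≤ n := by
    have := B.rank_le_height
    omega
  have hdet : IsUnit R.det := (Matrix.isUnit_iff_isUnit_det R).mp hR
  have hl : ∀ l : Fin b, (l : ℕ) < m := fun l => lt_of_lt_of_le l.isLt hm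
  generalize hX : blk m n b b 1 M N K = X
  have hY : Y = Y * R⁻¹ * R := by rw [Matrix.mul_assoc, Matrix.nonsing_inv_mul _ hdet, Matrix.mul_one]
  generalize Y * R⁻¹ = Y' at hY
  subst hY
  have e1 : D * (S * X * R) + Y' * R * (1 - B * (S * X * R)) =
      (D * S * X - Y' * (R * B * S) * X + Y') * R := by
    simp only [Matrix.mul_sub, Matrix.add_mul, Matrix.sub_mul, Matrix.mul_assoc, Matrix.mul_one]
    abel
  rw [e1, hRBS, mul_E n m b k hn, ← hX, mul_blk_one n m b k hm _ hD, mul_blk_one n m b k hm]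
  · congr 1
    have e2 : leftCols b (hstack k m b (leftCols b Y') 0) = leftCols b Y' := by
      ext i j
      simp [hstack, blk, leftCols, hl]
    rw [e2, Matrix.sub_mul]
    ext i j
    by_cases hj : (j : ℕ) < b
    · simp [hstack, blk, hj]
      simp [leftCols]
    · simp [hstack, blk, hj, rightCols, Nat.add_sub_of_le (not_lt.mp hj)]
  · intro j hj i
    simp [hstack, blk, not_lt.mpr hj]
end
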